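/- arXiv:2102.10328 — 6 statements merged into one kernel-verified Lean document; each statement's English description precedes it below -/
import Mathlib

section
/- For any permutation π of length n, the set D(π) has cardinality at most n. -/
/-- The subsequence of `π` indexed by `S` is increasing. -/
def IsIncOn {n : ℕ} (π : Equiv.Perm (Fin n)) (S : Set (Fin n)) : Prop :=
  ∀ i ∈ S, ∀ j ∈ S, i < j → π i < π j

/-- The subsequence of `π` indexed by `S` is decreasing. -/
def IsDecOn {n : ℕ} (π : Equiv.Perm (Fin n)) (S : Set (Fin n)) : Prop :=
  ∀ i ∈ S, ∀ j ∈ S, i < j → π j < π i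

/-- `π` is `(r,s)`-coverable: its index set can be partitioned into `r` sets
indexing increasing subsequences and `s` sets indexing decreasing subsequences. -/
def Coverable {n : ℕ} (π : Equiv.Perm (Fin n)) (r s : ℕ) : Prop :=
  ∃ c : Fin n → Fin r ⊕ Fin s,
    (∀ a : Fin r, IsIncOn π {i | c i = Sum.inl a}) ∧
    (∀ b : Fin s, IsDecOn π {i | c i = Sum.inr b})

/-- `π` is `k`-coverable: `(r,s)`-coverable for some `r + s = k`. -/
def KCoverable {n : ℕ} (π : Equiv.Perm (Fin n)) (k : ℕ) : Prop :=
  ∃ r s, r + s = k ∧ Coverable π r s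

/-- `τ` is a pattern of `π`. -/
def Pattern {m n : ℕ} (τ : Equiv.Perm (Fin m)) (π : Equiv.Perm (Fin n)) : Prop :=
  ∃ f : Fin m → Fin n, StrictMono f ∧ ∀ i j, τ i < τ j ↔ π (f i) < π (f j)

/-- `τ` is a proper pattern of `π`. -/
def ProperPattern {m n : ℕ} (τ : Equiv.Perm (Fin m)) (π : Equiv.Perm (Fin n)) : Prop :=
  m < n ∧ Pattern τ π

/-- `π` is `(r,s)`-critical. -/
def RSCritical {n : ℕ} (π : Equiv.Perm (Fin n)) (r s : ℕ) : Prop :=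
  ¬ Coverable π r s ∧
    ∀ (m : ℕ) (τ : Equiv.Perm (Fin m)), ProperPattern τ π → Coverable τ r s

/-- `π` is `k`-critical. -/
def KCritical {n : ℕ} (π : Equiv.Perm (Fin n)) (k : ℕ) : Prop :=
  ¬ KCoverable π k ∧
    ∀ (m : ℕ) (τ : Equiv.Perm (Fin m)), ProperPattern τ π → KCoverable τ k

/-- `π` is `(r,s)`-sharp: `(r,s)`-critical and `(0,s+1)`-coverable. -/
def RSSharp {n : ℕ} (π : Equiv.Perm (Fin n)) (r s : ℕ) : Prop :=
  RSCritical π r s ∧ Coverable π 0 (s + 1)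

/-- `D(π)`: the set of pairs `(r,s)` such that `π` is not `(r,s)`-coverable. -/
def DSet {n : ℕ} (π : Equiv.Perm (Fin n)) : Set (ℕ × ℕ) :=
  {p | ¬ Coverable π p.1 p.2}

/-- A downset: a finite, downward-closed subset of `ℕ²`. -/
def IsDownset (A : Set (ℕ × ℕ)) : Prop :=
  A.Finite ∧ ∀ p ∈ A, ∀ q : ℕ × ℕ, q.1 ≤ p.1 → q.2 ≤ p.2 → q ∈ A

/-- `A ⊕ B` for subsets of `ℕ²`. -/
def setOplus (A B : Set (ℕ × ℕ)) : Set (ℕ × ℕ) :=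
  {p | ∀ s₁ s₂ : ℕ, s₁ + s₂ = p.2 → (p.1, s₁) ∈ A ∨ (p.1, s₂) ∈ B}

/-- `A ⊖ B` for subsets of `ℕ²`. -/
def setOminus (A B : Set (ℕ × ℕ)) : Set (ℕ × ℕ) :=
  {p | ∀ r₁ r₂ : ℕ, r₁ + r₂ = p.1 → (r₁, p.2) ∈ A ∨ (r₂, p.2) ∈ B}

/-- `π` is `A`-coverable. -/
def ACoverable {n : ℕ} (π : Equiv.Perm (Fin n)) (A : Set (ℕ × ℕ)) : Prop :=
  ∃ p ∈ A, Coverable π p.1 p.2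

/-- `π` is `A`-critical. -/
def ACritical {n : ℕ} (π : Equiv.Perm (Fin n)) (A : Set (ℕ × ℕ)) : Prop :=
  ¬ ACoverable π A ∧
    ∀ (m : ℕ) (τ : Equiv.Perm (Fin m)), ProperPattern τ π → ACoverable τ A

/-- `π` is `A`-minimal: `A`-critical with `D(π) = A`. -/
def AMinimal {n : ℕ} (π : Equiv.Perm (Fin n)) (A : Set (ℕ × ℕ)) : Prop :=
  ACritical π A ∧ DSet π = A

/-- The triangle `T(k) = {(r,s) : r + s ≤ k}`. -/
def T (k : ℕ) : Set (ℕ × ℕ) := {p | p.1 + p.2 ≤ k}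

/-- Direct sum of permutations: `π` followed by `σ` shifted up by `n`. -/
def directSum {n m : ℕ} (π : Equiv.Perm (Fin n)) (σ : Equiv.Perm (Fin m)) :
    Equiv.Perm (Fin (n + m)) :=
  finSumFinEquiv.symm.trans ((Equiv.sumCongr π σ).trans finSumFinEquiv)

/-- Skew sum of permutations: `π` shifted up by `m`, followed by `σ`. -/
def skewSum {n m : ℕ} (π : Equiv.Perm (Fin n)) (σ : Equiv.Perm (Fin m)) :
    Equiv.Perm (Fin (n + m)) :=
  finSumFinEquiv.symm.trans (((Equiv.sumCongr π σ).trans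
    (Equiv.sumComm (Fin n) (Fin m))).trans
    (finSumFinEquiv.trans (finCongr (Nat.add_comm m n))))

/-- Tensor product of permutations: `n` copies of `σ`, ordered like `π`. -/
def tensorProd {n m : ℕ} (π : Equiv.Perm (Fin n)) (σ : Equiv.Perm (Fin m)) :
    Equiv.Perm (Fin (n * m)) :=
  finProdFinEquiv.symm.trans ((Equiv.prodCongr π σ).trans finProdFinEquiv)

/-- `CoverableOn π S r s` says that the subsequence of `π` indexed by `S` is
`(r,s)`-coverable. -/
def CoverableOn {n : ℕ} (π : Equiv.Perm (Fin n)) (S : Finset (Fin n)) (r s : ℕ) : Prop :=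
  ∃ c : S → Fin r ⊕ Fin s,
    (∀ a, ∀ i j : S, c i = Sum.inl a → c j = Sum.inl a → i.1 < j.1 → π i < π j) ∧
    (∀ b, ∀ i j : S, c i = Sum.inr b → c j = Sum.inr b → i.1 < j.1 → π j < π i)

theorem CoverableOn.coverable {n : ℕ} {π : Equiv.Perm (Fin n)} {r s : ℕ}
    (h : CoverableOn π Finset.univ r s) : Coverable π r s := by
  obtain ⟨c, hinc, hdec⟩ := h
  refine ⟨fun i => c ⟨i, Finset.mem_univ i⟩, ?_, ?_⟩
  · intro a i hi j hj hij
    exact hinc a ⟨i, Finset.mem_univ i⟩ ⟨j, Finset.mem_univ j⟩ hi hj hij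
  · intro b i hi j hj hij
    exact hdec b ⟨i, Finset.mem_univ i⟩ ⟨j, Finset.mem_univ j⟩ hi hj hij

theorem Sum.map_eq_inl_iff {α β γ δ : Type*} {f : α → γ} {g : β → δ} {x : α ⊕ β} {c : γ} :
    Sum.map f g x = Sum.inl c ↔ ∃ a, x = Sum.inl a ∧ f a = c := by
  cases x <;> simp

theorem Sum.map_eq_inr_iff {α β γ δ : Type*} {f : α → γ} {g : β → δ} {x : α ⊕ β} {d : δ} :
    Sum.map f g x = Sum.inr d ↔ ∃ b, x = Sum.inr b ∧ g b = d := by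
  cases x <;> simp

/-- Restoring an increasing subsequence costs one more increasing class. -/
theorem CoverableOn.of_sdiff {n : ℕ} {π : Equiv.Perm (Fin n)} {S T : Finset (Fin n)} {r s : ℕ}
    (hT : IsIncOn π T) (h : CoverableOn π (S \ T) r s) : CoverableOn π S (r + 1) s := by
  obtain ⟨c, hinc, hdec⟩ := h
  refine ⟨fun i => if hi : i.1 ∈ T then Sum.inl (Fin.last r)
    else Sum.map Fin.castSucc id (c ⟨i, Finset.mem_sdiff.2 ⟨i.2, hi⟩⟩), ?_, ?_⟩
  · intro a i j hi hj hij
    by_cases hiT : i.1 ∈ T <;> by_cases hjT : j.1 ∈ T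
    · exact hT _ hiT _ hjT hij
    · simp only [hiT, hjT, dite_true, dite_false, Sum.inl.injEq, Sum.map_eq_inl_iff] at hi hj
      obtain ⟨b, -, hb⟩ := hj
      exact absurd (hb.trans hi.symm) (Fin.castSucc_lt_last b).ne
    · simp only [hiT, hjT, dite_true, dite_false, Sum.inl.injEq, Sum.map_eq_inl_iff] at hi hj
      obtain ⟨b, -, hb⟩ := hi
      exact absurd (hb.trans hj.symm) (Fin.castSucc_lt_last b).ne
    · simp only [hiT, hjT, dite_false, Sum.map_eq_inl_iff] at hi hj
      obtain ⟨b, hb, rfl⟩ := hi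
      obtain ⟨b', hb', hbb⟩ := hj
      obtain rfl := Fin.castSucc_injective _ hbb
      exact hinc _ _ _ hb hb' hij
  · intro b i j hi hj hij
    by_cases hiT : i.1 ∈ T
    · simp [hiT] at hi
    by_cases hjT : j.1 ∈ T
    · simp [hjT] at hj
    simp only [hiT, hjT, dite_false, Sum.map_eq_inr_iff, id_eq, exists_eq_right] at hi hj
    exact hdec b _ _ hi hj hij

/-- The dual of Dilworth's theorem for subsequences: the length of a longest increasing
subsequence is the number of decreasing subsequences that suffice for a cover. -/
theorem exists_isIncOn_coverableOn {n : ℕ} (π : Equiv.Perm (Fin n)) (S : Finset (Fin n)) :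
    ∃ T ⊆ S, IsIncOn π T ∧ ∀ s, T.card ≤ s → CoverableOn π S 0 s := by
  classical
  obtain ⟨T, hT, hmax⟩ := Finset.exists_max_image
    (S.powerset.filter fun T : Finset (Fin n) => IsIncOn π T) Finset.card
    ⟨∅, by simp [IsIncOn]⟩
  simp only [Finset.mem_filter, Finset.mem_powerset] at hT hmax
  refine ⟨T, hT.1, hT.2, fun s hs => ?_⟩
  have key : ∀ i : S, ∃ U ⊆ S, IsIncOn π U ∧ i.1 ∈ U ∧ (∀ j ∈ U, j ≤ i.1) ∧
      ∀ V ⊆ S, IsIncOn π V → i.1 ∈ V → (∀ j ∈ V, j ≤ i.1) → V.card ≤ U.card := by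
    intro i
    obtain ⟨U, hU, hUmax⟩ := Finset.exists_max_image
      (S.powerset.filter fun U : Finset (Fin n) => IsIncOn π U ∧ i.1 ∈ U ∧ ∀ j ∈ U, j ≤ i.1)
      Finset.card
      ⟨{i.1}, by simp [IsIncOn]⟩
    simp only [Finset.mem_filter, Finset.mem_powerset] at hU hUmax
    exact ⟨U, hU.1, hU.2.1, hU.2.2.1, hU.2.2.2, fun V h₁ h₂ h₃ h₄ => hUmax V ⟨h₁, h₂, h₃, h₄⟩⟩
  choose U hUS hUinc hUmem hUle hUmax using key
  have hpos : ∀ i, 0 < (U i).card := fun i => Finset.card_pos.2 ⟨_, hUmem i⟩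
  have hle : ∀ i, (U i).card ≤ s := fun i => (hmax _ ⟨hUS i, hUinc i⟩).trans hs
  refine ⟨fun i => Sum.inr ⟨(U i).card - 1, by have := hpos i; have := hle i; omega⟩,
    fun a => a.elim0, fun b i j hi hj hij => ?_⟩
  have hcard : (U i).card = (U j).card := by
    have h := Sum.inr.inj (hi.trans hj.symm)
    have := hpos i
    have := hpos j
    simp only [Fin.mk.injEq] at h
    omega
  by_contra hlt
  have hπ : π i < π j := lt_of_le_of_ne (not_lt.1 hlt) fun h => hij.ne (π.injective h)
  have hnot : j.1 ∉ U i := fun h => absurd (hUle i _ h) (not_le.2 hij)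
  have hlast : ∀ x ∈ U i, π x < π j := fun x hx => by
    rcases (hUle i x hx).lt_or_eq with h | h
    · exact (hUinc i x hx _ (hUmem i) h).trans hπ
    · rwa [h]
  have := hUmax j (insert j.1 (U i)) (Finset.insert_subset j.2 (hUS i)) ?_
    (Finset.mem_insert_self _ _) ?_
  · rw [Finset.card_insert_of_notMem hnot] at this
    omega
  · intro x hx y hy hxy
    rcases Finset.mem_insert.1 (Finset.mem_coe.1 hx) with rfl | hx <;>
      rcases Finset.mem_insert.1 (Finset.mem_coe.1 hy) with rfl | hy
    · exact absurd hxy (lt_irrefl _)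
    · exact absurd (hxy.trans_le (hUle i y hy)) (not_lt.2 hij.le)
    · exact hlast x hx
    · exact hUinc i x hx y hy hxy
  · intro x hx
    rcases Finset.mem_insert.1 hx with rfl | hx
    · exact le_rfl
    · exact (hUle i x hx).trans hij.le

/-- Removing a longest increasing subsequence shifts the set of non-covering pairs by `(1, 0)`,
up to a first column whose height is the length of that subsequence. -/
theorem not_coverableOn_card_le {n : ℕ} (π : Equiv.Perm (Fin n)) (S : Finset (Fin n)) :
    {p : ℕ × ℕ | ¬ CoverableOn π S p.1 p.2}.Finite ∧
      {p : ℕ × ℕ | ¬ CoverableOn π S p.1 p.2}.ncard ≤ S.card := by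
  induction S using Finset.strongInduction with
  | H S ih =>
    obtain ⟨T, hTS, hT, hcov⟩ := exists_isIncOn_coverableOn π S
    rcases T.eq_empty_or_nonempty with rfl | hne
    · have hS : S = ∅ := by
        obtain ⟨c, -⟩ := hcov 0 (by simp)
        by_contra hS
        obtain ⟨i, hi⟩ := Finset.nonempty_iff_ne_empty.2 hS
        exact isEmptyElim (c ⟨i, hi⟩)
      subst hS
      have hall : ∀ r s, CoverableOn π ∅ r s := fun r s =>
        ⟨fun i => absurd i.2 (Finset.notMem_empty _),
          fun _ i => absurd i.2 (Finset.notMem_empty _),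
          fun _ i => absurd i.2 (Finset.notMem_empty _)⟩
      simp [hall]
    · obtain ⟨hfin, hcard⟩ := ih (S \ T) (Finset.sdiff_ssubset hTS hne)
      set D := {p : ℕ × ℕ | ¬ CoverableOn π (S \ T) p.1 p.2}
      set shifted := (fun p : ℕ × ℕ => (p.1 + 1, p.2)) '' D
      set column := (fun s : ℕ => ((0 : ℕ), s)) '' Set.Iio T.card
      have hsub : {p : ℕ × ℕ | ¬ CoverableOn π S p.1 p.2} ⊆ shifted ∪ column := by
        rintro ⟨_ | r, s⟩ hp
        · exact Or.inr ⟨s, not_le.1 fun h => hp (hcov s h), rfl⟩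
        · exact Or.inl ⟨(r, s), fun h => hp (h.of_sdiff hT), rfl⟩
      have hfin' : (shifted ∪ column).Finite :=
        (hfin.image _).union ((Set.finite_Iio _).image _)
      refine ⟨hfin'.subset hsub, (Set.ncard_le_ncard hsub hfin').trans ?_⟩
      have hshifted : shifted.ncard ≤ D.ncard := Set.ncard_image_le hfin
      have hcolumn : column.ncard ≤ T.card :=
        (Set.ncard_image_le (Set.finite_Iio _)).trans (by
          rw [← Finset.coe_Iio, Set.ncard_coe_finset, Nat.card_Iio])
      have hunion := Set.ncard_union_le shifted column
      have hsplit := Finset.card_sdiff_add_card_eq_card hTS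
      omega

/-- Lemma 2: `|D(π)| ≤ n` for a permutation `π` of length `n`. -/
theorem DSet_card_le {n : ℕ} (π : Equiv.Perm (Fin n)) :
    (DSet π).Finite ∧ (DSet π).ncard ≤ n := by
  obtain ⟨hfin, hcard⟩ := not_coverableOn_card_le π Finset.univ
  have hsub : DSet π ⊆ {p : ℕ × ℕ | ¬ CoverableOn π Finset.univ p.1 p.2} :=
    fun p hp h => hp h.coverable
  rw [Finset.card_univ, Fintype.card_fin] at hcard
  exact ⟨hfin.subset hsub, (Set.ncard_le_ncard hsub hfin).trans hcard⟩
end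

section
/- If π is an (r₁,s)-critical permutation and σ is an (r₂,s)-critical permutation, then the skew sum π ⊖ σ is (r₁+r₂+1, s)-critical. Symmetrically, if π is (r,s₁)-critical and σ is (r,s₂)-critical, then the direct sum π ⊕ σ is (r, s₁+s₂+1)-critical. -/
/-- The set `S` can be partitioned into `r` sets on which `A` holds between distinct elements and
`s` sets on which `B` does; `p` tells the two kinds of parts apart and `k` numbers them. -/
def CoverOn {α : Type*} (A B : α → α → Prop) (S : Set α) (r s : ℕ) : Prop :=
  ∃ (p : α → Prop) (k : α → ℕ),
    (∀ x ∈ S, (p x → k x < r) ∧ (¬ p x → k x < s)) ∧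
    ∀ x ∈ S, ∀ y ∈ S, x ≠ y → k x = k y → (p x → p y → A x y) ∧ (¬ p x → ¬ p y → B x y)

/-- `S` is not coverable, but becomes so when any one of its elements is removed. -/
def CriticalOn {α : Type*} (A B : α → α → Prop) (S : Set α) (r s : ℕ) : Prop :=
  ¬ CoverOn A B S r s ∧ ∀ x ∈ S, CoverOn A B (S \ {x}) r s

namespace CoverOn

variable {α β : Type*} {A B : α → α → Prop} {A₂ B₂ : β → β → Prop} {S X Y : Set α}
  {r r₁ r₂ s : ℕ}

theorem mono (h : CoverOn A B X r s) (hYX : Y ⊆ X) : CoverOn A B Y r s := by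
  obtain ⟨p, k, h₁, h₂⟩ := h
  exact ⟨p, k, fun x hx => h₁ x (hYX hx), fun x hx y hy => h₂ x (hYX hx) y (hYX hy)⟩

theorem swap (h : CoverOn A B S r s) : CoverOn B A S s r := by
  obtain ⟨p, k, h₁, h₂⟩ := h
  refine ⟨fun x => ¬ p x, k, fun x hx => ?_, fun x hx y hy hne hk => ?_⟩
  · have := h₁ x hx
    tauto
  · have := h₂ x hx y hy hne hk
    tauto

theorem image_iff {e : α → β} (he : Function.Injective e)
    (hA : ∀ x y, A x y ↔ A₂ (e x) (e y)) (hB : ∀ x y, B x y ↔ B₂ (e x) (e y)) :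
    CoverOn A₂ B₂ (e '' S) r s ↔ CoverOn A B S r s := by
  constructor
  · rintro ⟨p, k, h₁, h₂⟩
    refine ⟨p ∘ e, k ∘ e, fun x hx => h₁ _ (Set.mem_image_of_mem e hx),
      fun x hx y hy hne hk => ?_⟩
    rw [hA, hB]
    exact h₂ _ (Set.mem_image_of_mem e hx) _ (Set.mem_image_of_mem e hy) (he.ne hne) hk
  · rintro ⟨p, k, h₁, h₂⟩
    refine ⟨Function.extend e p fun _ => True, Function.extend e k 0, ?_, ?_⟩
    · rintro _ ⟨x, hx, rfl⟩
      simpa only [he.extend_apply] using h₁ x hx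
    · rintro _ ⟨x, hx, rfl⟩ _ ⟨y, hy, rfl⟩ hne
      simpa only [he.extend_apply, ← hA, ← hB] using h₂ x hx y hy (ne_of_apply_ne e hne)

/-- Adding a single element costs at most one more `A`-part. -/
theorem of_diff_singleton {x : α} (h : CoverOn A B (S \ {x}) r s) : CoverOn A B S (r + 1) s := by
  classical
  obtain ⟨p, k, h₁, h₂⟩ := h
  refine ⟨fun y => y = x ∨ p y, fun y => if y = x then r else k y, ?_, ?_⟩ <;>
    simp only [Set.mem_sdiff, Set.mem_singleton_iff] at h₁ h₂ <;> grind

theorem union (hX : CoverOn A B X r₁ s) (hY : CoverOn A B Y r₂ s)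
    (hB : ∀ x ∈ X, ∀ y ∈ Y, B x y ∧ B y x) : CoverOn A B (X ∪ Y) (r₁ + r₂) s := by
  classical
  obtain ⟨p, k, h₁, h₂⟩ := hX
  obtain ⟨q, l, h₃, h₄⟩ := hY
  refine ⟨fun x => if x ∈ X then p x else q x,
    fun x => if x ∈ X then k x else if q x then r₁ + l x else l x, ?_, ?_⟩ <;>
    simp only [Set.mem_union] <;> grind

/-- The `A`-parts may be renumbered by any finite set containing the labels in use. -/
theorem of_card_le {p : α → Prop} {k : α → ℕ} (I : Finset ℕ) (hI : I.card ≤ r)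
    (h₁ : ∀ x ∈ S, (p x → k x ∈ I) ∧ (¬ p x → k x < s))
    (h₂ : ∀ x ∈ S, ∀ y ∈ S, x ≠ y → k x = k y →
      (p x → p y → A x y) ∧ (¬ p x → ¬ p y → B x y)) : CoverOn A B S r s := by
  classical
  have hlt : ∀ a ∈ I, I.toList.idxOf a < r := fun a ha =>
    lt_of_lt_of_le (List.idxOf_lt_length_of_mem (by simpa using ha)) (by simpa using hI)
  have hinj : ∀ a ∈ I, ∀ b, I.toList.idxOf a = I.toList.idxOf b → a = b := fun a ha b h =>
    (List.idxOf_inj (by simpa using ha)).1 h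
  refine ⟨p, fun x => if p x then I.toList.idxOf (k x) else k x, fun x hx => ?_,
    fun x hx y hy hne hk => ?_⟩ <;> grind

end CoverOn

namespace CriticalOn

variable {α β : Type*} {A B : α → α → Prop} {A₂ B₂ : β → β → Prop} {S X Y : Set α}
  {r r₁ r₂ s : ℕ}

theorem swap (h : CriticalOn A B S r s) : CriticalOn B A S s r :=
  ⟨fun hc => h.1 hc.swap, fun x hx => (h.2 x hx).swap⟩

theorem image {e : α → β} (he : Function.Injective e)
    (hA : ∀ x y, A x y ↔ A₂ (e x) (e y)) (hB : ∀ x y, B x y ↔ B₂ (e x) (e y))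
    (h : CriticalOn A B S r s) : CriticalOn A₂ B₂ (e '' S) r s := by
  refine ⟨fun hc => h.1 ((CoverOn.image_iff he hA hB).1 hc), ?_⟩
  rintro _ ⟨x, hx, rfl⟩
  rw [← Set.image_singleton, ← Set.image_sdiff he]
  exact (CoverOn.image_iff he hA hB).2 (h.2 x hx)

theorem coverOn_succ (h : CriticalOn A B S r s) : CoverOn A B S (r + 1) s := by
  obtain rfl | ⟨x, hx⟩ := S.eq_empty_or_nonempty
  · exact ⟨fun _ => True, 0, by simp⟩
  · exact (h.2 x hx).of_diff_singleton

/-- Criticality of a union across which only `B` holds. -/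
theorem union (hX : CriticalOn A B X r₁ s) (hY : CriticalOn A B Y r₂ s)
    (hd : Disjoint X Y) (hA : ∀ x ∈ X, ∀ y ∈ Y, ¬ A x y)
    (hB : ∀ x ∈ X, ∀ y ∈ Y, B x y ∧ B y x) : CriticalOn A B (X ∪ Y) (r₁ + r₂ + 1) s := by
  classical
  refine ⟨?_, ?_⟩
  · rintro ⟨p, k, h₁, h₂⟩
    let I := (Finset.range (r₁ + r₂ + 1)).filter fun a => ∃ x ∈ X, p x ∧ k x = a
    let J := (Finset.range (r₁ + r₂ + 1)).filter fun a => ¬ ∃ x ∈ X, p x ∧ k x = a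
    have hcard : I.card + J.card = r₁ + r₂ + 1 := by
      simp only [I, J, Finset.card_filter_add_card_filter_not, Finset.card_range]
    have hsub : ∀ Z ⊆ X ∪ Y, ∀ x ∈ Z, ∀ y ∈ Z, x ≠ y → k x = k y →
        (p x → p y → A x y) ∧ (¬ p x → ¬ p y → B x y) :=
      fun Z hZ x hx y hy => h₂ x (hZ hx) y (hZ hy)
    obtain hI | hJ : I.card ≤ r₁ ∨ J.card ≤ r₂ := by omega
    · refine hX.1 (CoverOn.of_card_le I hI (fun x hx => ⟨fun hp => ?_, ?_⟩)
        (hsub X Set.subset_union_left))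
      · exact Finset.mem_filter.2 ⟨Finset.mem_range.2 ((h₁ x (.inl hx)).1 hp), x, hx, hp, rfl⟩
      · exact (h₁ x (.inl hx)).2
    · refine hY.1 (CoverOn.of_card_le J hJ (fun y hy => ⟨fun hp => ?_, ?_⟩)
        (hsub Y Set.subset_union_right))
      · refine Finset.mem_filter.2 ⟨Finset.mem_range.2 ((h₁ y (.inr hy)).1 hp), ?_⟩
        rintro ⟨x, hx, hpx, hk⟩
        exact hA x hx y hy ((h₂ x (.inl hx) y (.inr hy) (hd.ne_of_mem hx hy) hk).1 hpx hp)
      · exact (h₁ y (.inr hy)).2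
  · rintro x (hx | hx)
    · have h := (hX.2 x hx).union hY.coverOn_succ fun a ha b hb => hB a ha.1 b hb
      rw [← add_assoc] at h
      refine h.mono ?_
      rw [Set.union_sdiff_distrib]
      exact Set.union_subset_union_right _ Set.sdiff_subset
    · have h := hX.coverOn_succ.union (hY.2 x hx) fun a ha b hb => hB a ha b hb.1
      rw [add_right_comm] at h
      refine h.mono ?_
      rw [Set.union_sdiff_distrib]
      exact Set.union_subset_union_left _ Set.sdiff_subset

end CriticalOn

section Perm

variable {n m : ℕ}

/-- The positions `i` and `j` carry values of `π` in the same order. -/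
def Noninversion (π : Equiv.Perm (Fin n)) (i j : Fin n) : Prop :=
  i < j ↔ π i < π j

/-- The positions `i` and `j` carry values of `π` in the opposite order. -/
def Inversion (π : Equiv.Perm (Fin n)) (i j : Fin n) : Prop :=
  i < j ↔ π j < π i

theorem coverable_iff_coverOn (π : Equiv.Perm (Fin n)) (r s : ℕ) :
    Coverable π r s ↔ CoverOn (Noninversion π) (Inversion π) Set.univ r s := by
  classical
  constructor
  · rintro ⟨c, hi, hd⟩
    refine ⟨fun x => (c x).isLeft, fun x => (c x).elim Fin.val Fin.val, fun x _ => ?_,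
      fun x _ y _ hne hk => ?_⟩
    · cases h : c x <;> simp [h]
    · cases hx : c x with
      | inl a =>
        cases hy : c y with
        | inl b =>
          obtain rfl : a = b := by simpa [hx, hy, Fin.ext_iff] using hk
          have h₁ := hi a x hx y hy
          have h₂ := hi a y hy x hx
          simp only [hx, hy, Sum.isLeft_inl, Noninversion]
          grind
        | inr b => simp [hx, hy]
      | inr a =>
        cases hy : c y with
        | inl b => simp [hx, hy]
        | inr b =>
          obtain rfl : a = b := by simpa [hx, hy, Fin.ext_iff] using hk
          have h₁ := hd a x hx y hy
          have h₂ := hd a y hy x hx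
          simp only [hx, hy, Sum.isLeft_inr, Inversion]
          grind
  · rintro ⟨p, k, h₁, h₂⟩
    refine ⟨fun x => if h : p x then .inl ⟨k x, (h₁ x trivial).1 h⟩
      else .inr ⟨k x, (h₁ x trivial).2 h⟩, fun a x hx y hy hlt => ?_, fun b x hx y hy hlt => ?_⟩
    all_goals
      simp only [Set.mem_ofPred_eq] at hx hy
      have h := h₂ x trivial y trivial hlt.ne
      simp only [Noninversion, Inversion] at h
      split_ifs at hx hy
      grind

theorem Pattern.coverOn_range_iff {τ : Equiv.Perm (Fin m)} {π : Equiv.Perm (Fin n)}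
    {f : Fin m → Fin n} (hf : StrictMono f) (h : ∀ i j, τ i < τ j ↔ π (f i) < π (f j))
    (r s : ℕ) :
    CoverOn (Noninversion π) (Inversion π) (Set.range f) r s ↔ Coverable τ r s := by
  rw [coverable_iff_coverOn, ← Set.image_univ]
  refine CoverOn.image_iff hf.injective (fun i j => ?_) (fun i j => ?_) <;>
    simp only [Noninversion, Inversion, hf.lt_iff_lt, h]

/-- Deleting the entry at position `x` leaves a pattern on the remaining positions. -/
theorem exists_perm_succAbove (π : Equiv.Perm (Fin (n + 1))) (x : Fin (n + 1)) :
    ∃ τ : Equiv.Perm (Fin n),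
      ∀ i j, τ i < τ j ↔ π (x.succAbove i) < π (x.succAbove j) := by
  let e : {y // y ≠ x} ≃ {y // y ≠ π x} := π.subtypeEquiv fun y => π.injective.ne_iff.symm
  refine ⟨(finSuccAboveEquiv x).trans (e.trans (finSuccAboveEquiv (π x)).symm), fun i j => ?_⟩
  have succAbove_symm (y) : (π x).succAbove ((finSuccAboveEquiv (π x)).symm y) = y :=
    congrArg Subtype.val ((finSuccAboveEquiv (π x)).apply_symm_apply y)
  rw [← (Fin.strictMono_succAbove (π x)).lt_iff_lt]
  simp only [Equiv.trans_apply, succAbove_symm]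
  rfl

theorem rsCritical_iff_criticalOn (π : Equiv.Perm (Fin n)) (r s : ℕ) :
    RSCritical π r s ↔ CriticalOn (Noninversion π) (Inversion π) Set.univ r s := by
  refine and_congr (coverable_iff_coverOn π r s).not ⟨fun h x _ => ?_, ?_⟩
  · obtain _ | n := n
    · exact x.elim0
    obtain ⟨τ, hτ⟩ := exists_perm_succAbove π x
    have hx := Fin.strictMono_succAbove x
    rw [← Set.compl_eq_univ_sdiff, ← Fin.range_succAbove, Pattern.coverOn_range_iff hx hτ]
    exact h n τ ⟨n.lt_succ_self, _, hx, hτ⟩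
  · rintro h m τ ⟨hmn, f, hf, hτ⟩
    have hns : ¬ Function.Surjective f := fun hs =>
      hmn.not_ge (by simpa using Fintype.card_le_of_surjective f hs)
    obtain ⟨x, hx⟩ := not_forall.1 hns
    rw [← Pattern.coverOn_range_iff hf hτ]
    exact (h x trivial).mono fun y hy => ⟨trivial, fun hyx => hx (hyx ▸ hy)⟩

@[simp]
theorem val_directSum_castAdd (π : Equiv.Perm (Fin n)) (σ : Equiv.Perm (Fin m)) (i : Fin n) :
    (directSum π σ (Fin.castAdd m i) : ℕ) = π i := by
  simp [directSum]

@[simp]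
theorem val_directSum_natAdd (π : Equiv.Perm (Fin n)) (σ : Equiv.Perm (Fin m)) (i : Fin m) :
    (directSum π σ (Fin.natAdd n i) : ℕ) = n + σ i := by
  simp [directSum]

@[simp]
theorem val_skewSum_castAdd (π : Equiv.Perm (Fin n)) (σ : Equiv.Perm (Fin m)) (i : Fin n) :
    (skewSum π σ (Fin.castAdd m i) : ℕ) = m + π i := by
  simp [skewSum, add_comm]

@[simp]
theorem val_skewSum_natAdd (π : Equiv.Perm (Fin n)) (σ : Equiv.Perm (Fin m)) (i : Fin m) :
    (skewSum π σ (Fin.natAdd n i) : ℕ) = σ i := by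
  simp [skewSum]

theorem range_castAdd_union_range_natAdd :
    Fin.castAdd m '' Set.univ ∪ Fin.natAdd n '' Set.univ = (Set.univ : Set (Fin (n + m))) := by
  refine Set.eq_univ_of_forall fun x => ?_
  induction x using Fin.addCases <;> simp

theorem disjoint_range_castAdd_range_natAdd :
    Disjoint (Fin.castAdd m '' Set.univ) (Fin.natAdd n '' (Set.univ : Set (Fin m))) := by
  rw [Set.disjoint_left]
  rintro _ ⟨i, -, rfl⟩ ⟨j, -, h⟩
  have := congrArg Fin.val h
  simp at this
  omega

theorem RSCritical.skewSum {r₁ r₂ s : ℕ} {π : Equiv.Perm (Fin n)} {σ : Equiv.Perm (Fin m)}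
    (hπ : RSCritical π r₁ s) (hσ : RSCritical σ r₂ s) :
    RSCritical (skewSum π σ) (r₁ + r₂ + 1) s := by
  rw [rsCritical_iff_criticalOn] at *
  rw [← range_castAdd_union_range_natAdd]
  refine (hπ.image (Fin.castAdd_injective n m) ?_ ?_).union
    (hσ.image (Fin.natAdd_injective m n) ?_ ?_) disjoint_range_castAdd_range_natAdd ?_ ?_
  all_goals
    simp only [Noninversion, Inversion, Fin.lt_def, Set.forall_mem_image, Set.mem_univ,
      true_imp_iff, val_skewSum_castAdd, val_skewSum_natAdd, Fin.val_castAdd, Fin.val_natAdd]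
    omega

theorem RSCritical.directSum {r s₁ s₂ : ℕ} {π : Equiv.Perm (Fin n)} {σ : Equiv.Perm (Fin m)}
    (hπ : RSCritical π r s₁) (hσ : RSCritical σ r s₂) :
    RSCritical (directSum π σ) r (s₁ + s₂ + 1) := by
  rw [rsCritical_iff_criticalOn] at *
  rw [← range_castAdd_union_range_natAdd]
  refine ((hπ.swap.image (Fin.castAdd_injective n m) ?_ ?_).union
    (hσ.swap.image (Fin.natAdd_injective m n) ?_ ?_)
    disjoint_range_castAdd_range_natAdd ?_ ?_).swap
  all_goals
    simp only [Noninversion, Inversion, Fin.lt_def, Set.forall_mem_image, Set.mem_univ,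
      true_imp_iff, val_directSum_castAdd, val_directSum_natAdd, Fin.val_castAdd, Fin.val_natAdd,
      implies_true] <;> omega

end Perm

/-- Lemma 3: skew sums of critical permutations, and direct sums of critical
permutations, are critical. -/
theorem critical_sums :
    (∀ (n m r₁ r₂ s : ℕ) (π : Equiv.Perm (Fin n)) (σ : Equiv.Perm (Fin m)),
      RSCritical π r₁ s → RSCritical σ r₂ s →
        RSCritical (skewSum π σ) (r₁ + r₂ + 1) s) ∧
    (∀ (n m r s₁ s₂ : ℕ) (π : Equiv.Perm (Fin n)) (σ : Equiv.Perm (Fin m)),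
      RSCritical π r s₁ → RSCritical σ r s₂ →
        RSCritical (directSum π σ) r (s₁ + s₂ + 1)) :=
  ⟨fun _ _ _ _ _ _ _ hπ hσ => hπ.skewSum hσ, fun _ _ _ _ _ _ _ hπ hσ => hπ.directSum hσ⟩
end

section
/- Let k ∈ ℕ. If π is a T(k)-minimal permutation and σ is a T(k+1)-minimal permutation, then (π ⊕ π) ⊖ (π ⊕ σ) is T(2k+2)-minimal and (π ⊕ σ) ⊖ (σ ⊕ σ) is T(2k+3)-minimal. -/
/-- A colouring `c` of `S` in which every `inl` colour is less than `r` and its class is pairwise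
related by `u`, and every `inr` colour is less than `s` and its class is pairwise unrelated. -/
structure IsCover {α : Type*} (u : α → α → Prop) (S : Set α) (r s : ℕ) (c : α → ℕ ⊕ ℕ) :
    Prop where
  inl_lt : ∀ i ∈ S, ∀ a, c i = Sum.inl a → a < r
  inr_lt : ∀ i ∈ S, ∀ b, c i = Sum.inr b → b < s
  rel : ∀ i ∈ S, ∀ j ∈ S, i ≠ j → ∀ a, c i = Sum.inl a → c j = Sum.inl a → u i j
  not_rel : ∀ i ∈ S, ∀ j ∈ S, i ≠ j → ∀ b, c i = Sum.inr b → c j = Sum.inr b → ¬ u i j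

/-- `S` is covered by `r` classes of pairwise related and `s` classes of pairwise unrelated
elements. -/
def RelCover {α : Type*} (u : α → α → Prop) (S : Set α) (r s : ℕ) : Prop :=
  ∃ c, IsCover u S r s c

namespace RelCover

variable {α β : Type*} {u : α → α → Prop} {v : β → β → Prop} {S : Set α} {r s : ℕ}

theorem mono {r' s' : ℕ} (h : RelCover u S r s) (hr : r ≤ r') (hs : s ≤ s') :
    RelCover u S r' s' := by
  obtain ⟨c, h₁, h₂, h₃, h₄⟩ := h
  exact ⟨c, fun i hi a ha => (h₁ i hi a ha).trans_le hr,
    fun i hi a ha => (h₂ i hi a ha).trans_le hs, h₃, h₄⟩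

theorem comap {S' : Set β} (h : RelCover u S r s) (f : β → α) (hf : Function.Injective f)
    (hS : ∀ i ∈ S', f i ∈ S) (huv : ∀ i j, v i j ↔ u (f i) (f j)) : RelCover v S' r s := by
  obtain ⟨c, h₁, h₂, h₃, h₄⟩ := h
  refine ⟨c ∘ f, fun i hi => h₁ _ (hS i hi), fun i hi => h₂ _ (hS i hi), ?_, ?_⟩
  · intro i hi j hj hij a ha hb
    exact (huv i j).2 (h₃ _ (hS i hi) _ (hS j hj) (hf.ne hij) a ha hb)
  · intro i hi j hj hij a ha hb
    exact fun h => h₄ _ (hS i hi) _ (hS j hj) (hf.ne hij) a ha hb ((huv i j).1 h)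

theorem image (h : RelCover u S r s) (f : α → β) (hf : Function.Injective f)
    (huv : ∀ i j, u i j ↔ v (f i) (f j)) : RelCover v (f '' S) r s := by
  obtain ⟨c, h₁, h₂, h₃, h₄⟩ := h
  refine ⟨Function.extend f c fun _ => Sum.inl 0, ?_, ?_, ?_, ?_⟩
  · rintro _ ⟨i, hi, rfl⟩
    simpa only [hf.extend_apply] using h₁ i hi
  · rintro _ ⟨i, hi, rfl⟩
    simpa only [hf.extend_apply] using h₂ i hi
  · rintro _ ⟨i, hi, rfl⟩ _ ⟨j, hj, rfl⟩ hij
    simpa only [hf.extend_apply, ← huv] using h₃ i hi j hj (ne_of_apply_ne f hij)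
  · rintro _ ⟨i, hi, rfl⟩ _ ⟨j, hj, rfl⟩ hij
    simpa only [hf.extend_apply, ← huv] using h₄ i hi j hj (ne_of_apply_ne f hij)

theorem compl (h : RelCover u S r s) : RelCover (fun i j => ¬ u i j) S s r := by
  obtain ⟨c, h₁, h₂, h₃, h₄⟩ := h
  have hl : ∀ i a, (c i).swap = Sum.inl a ↔ c i = Sum.inr a := fun i a => by
    cases c i <;> simp
  have hr : ∀ i a, (c i).swap = Sum.inr a ↔ c i = Sum.inl a := fun i a => by
    cases c i <;> simp
  refine ⟨fun i => (c i).swap, ?_, ?_, ?_, ?_⟩ <;> simp only [hl, hr, not_not] <;> assumption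

theorem compl_iff : RelCover (fun i j => ¬ u i j) S s r ↔ RelCover u S r s :=
  ⟨fun h => by simpa only [not_not] using h.compl, compl⟩

/-- Only the number of `inr` colours matters, not which ones are used. -/
theorem of_inr_mem {c : α → ℕ ⊕ ℕ} {t : ℕ} (hc : IsCover u S r s c) (B : Finset ℕ)
    (hB : ∀ i ∈ S, ∀ b, c i = Sum.inr b → b ∈ B) (hcard : B.card ≤ t) : RelCover u S r t := by
  obtain ⟨h₁, h₂, h₃, h₄⟩ := hc
  refine ⟨fun i => (c i).map id (Nat.count (· ∈ B)), ?_, ?_, ?_, ?_⟩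
  · intro i hi a ha
    rcases hci : c i with x | x <;> simp only [hci, Sum.map_inl, Sum.map_inr, id] at ha
    · exact h₁ i hi a (hci.trans ha)
    · cases ha
  · intro i hi a ha
    rcases hci : c i with x | x <;> simp only [hci, Sum.map_inl, Sum.map_inr, id] at ha
    · cases ha
    · have hlt := Nat.count_lt_card (p := (· ∈ B)) B.finite_toSet (hB i hi x hci)
      rw [Finset.finite_toSet_toFinset, Sum.inr.inj ha] at hlt
      exact hlt.trans_le hcard
  · intro i hi j hj hij a ha hb
    rcases hci : c i with x | x <;> simp only [hci, Sum.map_inl, Sum.map_inr, id] at ha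
    · rcases hcj : c j with y | y <;> simp only [hcj, Sum.map_inl, Sum.map_inr, id] at hb
      · exact h₃ i hi j hj hij a (hci.trans ha) (hcj.trans hb)
      · cases hb
    · cases ha
  · intro i hi j hj hij a ha hb
    rcases hci : c i with x | x <;> simp only [hci, Sum.map_inl, Sum.map_inr, id] at ha
    · cases ha
    · rcases hcj : c j with y | y <;> simp only [hcj, Sum.map_inl, Sum.map_inr, id] at hb
      · cases hb
      · have hxy : x = y := Nat.count_injective (p := (· ∈ B)) (hB i hi x hci) (hB j hj y hcj)
          ((Sum.inr.inj ha).trans (Sum.inr.inj hb).symm)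
        exact h₄ i hi j hj hij x hci (hxy ▸ hcj)

end RelCover

/-- The relation on `α ⊕ β` extending `u` and `v`, with constant value `w` across the summands. -/
def sumRel {α β : Type*} (u : α → α → Prop) (v : β → β → Prop) (w : Prop) :
    α ⊕ β → α ⊕ β → Prop
  | Sum.inl i, Sum.inl j => u i j
  | Sum.inr i, Sum.inr j => v i j
  | _, _ => w

section SumRel

variable {α β : Type*} {u : α → α → Prop} {v : β → β → Prop} {S : Set (α ⊕ β)} {r s : ℕ}

theorem not_sumRel {w : Prop} (i j : α ⊕ β) :
    ¬ sumRel u v w i j ↔ sumRel (fun i j => ¬ u i j) (fun i j => ¬ v i j) (¬ w) i j := by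
  cases i <;> cases j <;> rfl

theorem relCover_sumRel_true :
    RelCover (sumRel u v True) S r s ↔ ∃ s₁ s₂, s₁ + s₂ = s ∧
      RelCover u (Sum.inl ⁻¹' S) r s₁ ∧ RelCover v (Sum.inr ⁻¹' S) r s₂ := by
  classical
  constructor
  · rintro ⟨c, h₁, h₂, h₃, h₄⟩
    let B := (Finset.range s).filter fun b => ∃ i, Sum.inl i ∈ S ∧ c (Sum.inl i) = Sum.inr b
    have hBs : B ⊆ Finset.range s := Finset.filter_subset _ _
    have hBcard : B.card ≤ s := by simpa using Finset.card_le_card hBs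
    refine ⟨B.card, s - B.card, by omega, ?_, ?_⟩
    · refine RelCover.of_inr_mem (c := c ∘ Sum.inl) (s := s) ⟨fun i hi => h₁ _ hi,
        fun i hi => h₂ _ hi, fun i hi j hj hij => h₃ _ hi _ hj (Sum.inl_injective.ne hij),
        fun i hi j hj hij => h₄ _ hi _ hj (Sum.inl_injective.ne hij)⟩ B ?_ le_rfl
      intro i hi b hb
      exact Finset.mem_filter.2 ⟨Finset.mem_range.2 (h₂ _ hi b hb), i, hi, hb⟩
    · refine RelCover.of_inr_mem (c := c ∘ Sum.inr) (s := s) ⟨fun i hi => h₁ _ hi,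
        fun i hi => h₂ _ hi, fun i hi j hj hij => h₃ _ hi _ hj (Sum.inr_injective.ne hij),
        fun i hi j hj hij => h₄ _ hi _ hj (Sum.inr_injective.ne hij)⟩ (Finset.range s \ B) ?_ ?_
      · intro i hi b hb
        refine Finset.mem_sdiff.2 ⟨Finset.mem_range.2 (h₂ _ hi b hb), fun hbB => ?_⟩
        obtain ⟨-, j, hj, hjb⟩ := Finset.mem_filter.1 hbB
        exact h₄ _ hj _ hi Sum.inl_ne_inr b hjb hb trivial
      · rw [Finset.card_sdiff_of_subset hBs, Finset.card_range]
  · rintro ⟨s₁, s₂, rfl, ⟨c, h₁, h₂, h₃, h₄⟩, ⟨d, k₁, k₂, k₃, k₄⟩⟩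
    have inl_of : ∀ j a, (d j).map id (· + s₁) = Sum.inl a → d j = Sum.inl a := by
      intro j a h
      rcases hj : d j with x | x <;> simp_all
    have inr_of : ∀ j b, (d j).map id (· + s₁) = Sum.inr b →
        ∃ x, d j = Sum.inr x ∧ x + s₁ = b := by
      intro j b h
      rcases hj : d j with x | x <;> simp_all
    refine ⟨Sum.elim c fun j => (d j).map id (· + s₁), ?_, ?_, ?_, ?_⟩
    · rintro (i | i) hi a ha
      · exact h₁ i hi a ha
      · exact k₁ i hi a (inl_of i a ha)
    · rintro (i | i) hi b hb
      · exact (h₂ i hi b hb).trans_le (Nat.le_add_right _ _)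
      · obtain ⟨x, hx, rfl⟩ := inr_of i b hb
        have := k₂ i hi x hx
        omega
    · rintro (i | i) hi (j | j) hj hij a ha hb
      · exact h₃ i hi j hj (ne_of_apply_ne _ hij) a ha hb
      · trivial
      · trivial
      · exact k₃ i hi j hj (ne_of_apply_ne _ hij) a (inl_of i a ha) (inl_of j a hb)
    · rintro (i | i) hi (j | j) hj hij b ha hb
      · exact h₄ i hi j hj (ne_of_apply_ne _ hij) b ha hb
      · obtain ⟨x, -, rfl⟩ := inr_of j b hb
        exact absurd (h₂ i hi _ ha) (by omega)
      · obtain ⟨x, -, rfl⟩ := inr_of i b ha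
        exact absurd (h₂ j hj _ hb) (by omega)
      · obtain ⟨x, hx, rfl⟩ := inr_of i b ha
        obtain ⟨y, hy, hxy⟩ := inr_of j _ hb
        obtain rfl : y = x := by omega
        exact k₄ i hi j hj (ne_of_apply_ne _ hij) y hx hy

theorem relCover_sumRel_false :
    RelCover (sumRel u v False) S r s ↔ ∃ r₁ r₂, r₁ + r₂ = r ∧
      RelCover u (Sum.inl ⁻¹' S) r₁ s ∧ RelCover v (Sum.inr ⁻¹' S) r₂ s := by
  rw [← RelCover.compl_iff]
  simp only [not_sumRel, not_false_eq_true, relCover_sumRel_true, RelCover.compl_iff]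

end SumRel

/-- The relational counterpart of `T(k)`-minimality. -/
structure RelMinimal {α : Type*} (u : α → α → Prop) (k : ℕ) : Prop where
  cover_iff : ∀ r s, RelCover u Set.univ r s ↔ k < r + s
  cover_compl : ∀ x, ∃ r s, r + s = k ∧ RelCover u {x}ᶜ r s

theorem RelMinimal.congr {α β : Type*} {u : α → α → Prop} {v : β → β → Prop} {k : ℕ}
    (h : RelMinimal u k) (e : α ≃ β) (huv : ∀ i j, v (e i) (e j) ↔ u i j) : RelMinimal v k := by
  have huv' : ∀ i j, v i j ↔ u (e.symm i) (e.symm j) := fun i j => by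
    rw [← huv, e.apply_symm_apply, e.apply_symm_apply]
  refine ⟨fun r s => ?_, fun x => ?_⟩
  · rw [← h.cover_iff]
    exact ⟨fun hc => hc.comap e e.injective (fun _ _ => trivial) fun i j => (huv i j).symm,
      fun hc => hc.comap e.symm e.symm.injective (fun _ _ => trivial) huv'⟩
  · obtain ⟨r, s, hrs, hc⟩ := h.cover_compl (e.symm x)
    refine ⟨r, s, hrs, hc.comap e.symm e.symm.injective (fun i hi => ?_) huv'⟩
    simpa using hi

section Doubling

variable {α β : Type*} {u : α → α → Prop} {v : β → β → Prop} {k : ℕ}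

theorem inl_preimage_compl_inl (x : α) :
    (Sum.inl ⁻¹' {(Sum.inl x : α ⊕ β)}ᶜ : Set α) = {x}ᶜ := by
  ext; simp

theorem inr_preimage_compl_inl (x : α) :
    (Sum.inr ⁻¹' {(Sum.inl x : α ⊕ β)}ᶜ : Set β) = Set.univ := by
  ext; simp

theorem inl_preimage_compl_inr (x : β) :
    (Sum.inl ⁻¹' {(Sum.inr x : α ⊕ β)}ᶜ : Set α) = Set.univ := by
  ext; simp

theorem inr_preimage_compl_inr (x : β) :
    (Sum.inr ⁻¹' {(Sum.inr x : α ⊕ β)}ᶜ : Set β) = {x}ᶜ := by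
  ext; simp

theorem RelMinimal.doubling_even (hu : RelMinimal u k) (hv : RelMinimal v (k + 1)) :
    RelMinimal (sumRel (sumRel u u True) (sumRel u v True) False) (2 * k + 2) := by
  constructor
  · intro r s
    simp only [relCover_sumRel_false, relCover_sumRel_true, Set.preimage_univ, hu.cover_iff,
      hv.cover_iff]
    constructor
    · rintro ⟨r₁, r₂, rfl, ⟨s₁, s₂, rfl, h₁, h₂⟩, s₃, s₄, h, h₃, h₄⟩
      omega
    · intro h
      exact ⟨k + 1 - s / 2, r - (k + 1 - s / 2), by omega,
        ⟨s / 2, s - s / 2, by omega, by omega, by omega⟩,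
        s / 2, s - s / 2, by omega, by omega, by omega⟩
  · simp only [relCover_sumRel_false, relCover_sumRel_true]
    rintro ((x | x) | (x | x)) <;>
      simp only [inl_preimage_compl_inl, inr_preimage_compl_inl, inl_preimage_compl_inr,
        inr_preimage_compl_inr, Set.preimage_univ, hu.cover_iff, hv.cover_iff]
    · obtain ⟨r, s, hrs, h⟩ := hu.cover_compl x
      exact ⟨r + (k + 1 - s), 2 * s + 1, by omega, r, k + 1 - s, rfl,
        ⟨s, s + 1, by omega, h, by omega⟩, s, s + 1, by omega, by omega, by omega⟩
    · obtain ⟨r, s, hrs, h⟩ := hu.cover_compl x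
      exact ⟨r + (k + 1 - s), 2 * s + 1, by omega, r, k + 1 - s, rfl,
        ⟨s + 1, s, by omega, by omega, h⟩, s, s + 1, by omega, by omega, by omega⟩
    · obtain ⟨r, s, hrs, h⟩ := hu.cover_compl x
      exact ⟨k - s + r, 2 * s + 2, by omega, k - s, r, rfl,
        ⟨s + 1, s + 1, by omega, by omega, by omega⟩, s, s + 2, by omega, h, by omega⟩
    · obtain ⟨r, s, hrs, h⟩ := hv.cover_compl x
      exact ⟨k + 1 - s + r, 2 * s, by omega, k + 1 - s, r, rfl,
        ⟨s, s, by omega, by omega, by omega⟩, s, s, by omega, by omega, h⟩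

theorem RelMinimal.doubling_odd (hu : RelMinimal u k) (hv : RelMinimal v (k + 1)) :
    RelMinimal (sumRel (sumRel u v True) (sumRel v v True) False) (2 * k + 3) := by
  constructor
  · intro r s
    simp only [relCover_sumRel_false, relCover_sumRel_true, Set.preimage_univ, hu.cover_iff,
      hv.cover_iff]
    constructor
    · rintro ⟨r₁, r₂, rfl, ⟨s₁, s₂, rfl, h₁, h₂⟩, s₃, s₄, h, h₃, h₄⟩
      omega
    · intro h
      exact ⟨r - (k + 2 - s / 2), k + 2 - s / 2, by omega,
        ⟨s / 2, s - s / 2, by omega, by omega, by omega⟩,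
        s / 2, s - s / 2, by omega, by omega, by omega⟩
  · simp only [relCover_sumRel_false, relCover_sumRel_true]
    rintro ((x | x) | (x | x)) <;>
      simp only [inl_preimage_compl_inl, inr_preimage_compl_inl, inl_preimage_compl_inr,
        inr_preimage_compl_inr, Set.preimage_univ, hu.cover_iff, hv.cover_iff]
    · obtain ⟨r, s, hrs, h⟩ := hu.cover_compl x
      exact ⟨r + (k + 1 - s), 2 * s + 2, by omega, r, k + 1 - s, rfl,
        ⟨s, s + 2, by omega, h, by omega⟩, s + 1, s + 1, by omega, by omega, by omega⟩
    · obtain ⟨r, s, hrs, h⟩ := hv.cover_compl x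
      exact ⟨r + (k + 2 - s), 2 * s, by omega, r, k + 2 - s, rfl,
        ⟨s, s, by omega, by omega, h⟩, s, s, by omega, by omega, by omega⟩
    · obtain ⟨r, s, hrs, h⟩ := hv.cover_compl x
      exact ⟨k + 1 - s + r, 2 * s + 1, by omega, k + 1 - s, r, rfl,
        ⟨s, s + 1, by omega, by omega, by omega⟩, s, s + 1, by omega, h, by omega⟩
    · obtain ⟨r, s, hrs, h⟩ := hv.cover_compl x
      exact ⟨k + 1 - s + r, 2 * s + 1, by omega, k + 1 - s, r, rfl,
        ⟨s, s + 1, by omega, by omega, by omega⟩, s + 1, s, by omega, by omega, h⟩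

end Doubling

/-- `i` and `j` are not inverted by `π`. -/
def NonInv {n : ℕ} (π : Equiv.Perm (Fin n)) (i j : Fin n) : Prop := i < j ↔ π i < π j

theorem isIncOn_iff {n : ℕ} (π : Equiv.Perm (Fin n)) (S : Set (Fin n)) :
    IsIncOn π S ↔ ∀ i ∈ S, ∀ j ∈ S, i ≠ j → NonInv π i j := by
  constructor
  · intro h i hi j hj hij
    rcases lt_or_gt_of_ne hij with hlt | hlt
    · exact iff_of_true hlt (h i hi j hj hlt)
    · exact iff_of_false hlt.asymm (h j hj i hi hlt).asymm
  · intro h i hi j hj hij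
    exact (h i hi j hj hij.ne).1 hij

theorem isDecOn_iff {n : ℕ} (π : Equiv.Perm (Fin n)) (S : Set (Fin n)) :
    IsDecOn π S ↔ ∀ i ∈ S, ∀ j ∈ S, i ≠ j → ¬ NonInv π i j := by
  constructor
  · intro h i hi j hj hij hn
    rcases lt_or_gt_of_ne hij with hlt | hlt
    · exact (h i hi j hj hlt).asymm (hn.1 hlt)
    · exact hlt.asymm (hn.2 (h j hj i hi hlt))
  · intro h i hi j hj hij
    have hπ : ¬ π i < π j := fun hlt => h i hi j hj hij.ne (iff_of_true hij hlt)
    exact lt_of_le_of_ne (not_lt.1 hπ) (π.injective.ne hij.ne')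

theorem coverable_iff_relCover {n : ℕ} (π : Equiv.Perm (Fin n)) (r s : ℕ) :
    Coverable π r s ↔ RelCover (NonInv π) Set.univ r s := by
  constructor
  · rintro ⟨c, hinc, hdec⟩
    simp only [isIncOn_iff, isDecOn_iff, Set.mem_ofPred_eq] at hinc hdec
    refine ⟨fun i => (c i).map Fin.val Fin.val, ?_, ?_, ?_, ?_⟩
    · intro i _ a ha
      rcases hi : c i with x | x <;> simp only [hi, Sum.map_inl, Sum.map_inr] at ha
      · exact Sum.inl.inj ha ▸ x.isLt
      · cases ha
    · intro i _ b hb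
      rcases hi : c i with x | x <;> simp only [hi, Sum.map_inl, Sum.map_inr] at hb
      · cases hb
      · exact Sum.inr.inj hb ▸ x.isLt
    · intro i _ j _ hij a ha hb
      have hcc : c i = c j :=
        (Fin.val_injective.sumMap Fin.val_injective) (ha.trans hb.symm)
      rcases hi : c i with x | x
      · exact hinc x i hi j (hcc ▸ hi) hij
      · simp [hi] at ha
    · intro i _ j _ hij b ha hb
      have hcc : c i = c j :=
        (Fin.val_injective.sumMap Fin.val_injective) (ha.trans hb.symm)
      rcases hi : c i with x | x
      · simp [hi] at ha
      · exact hdec x i hi j (hcc ▸ hi) hij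
  · rintro ⟨c, h₁, h₂, h₃, h₄⟩
    have hd : ∀ i, ∃ d : Fin r ⊕ Fin s, c i = d.map Fin.val Fin.val := by
      intro i
      rcases hi : c i with x | x
      · exact ⟨Sum.inl ⟨x, h₁ i trivial x hi⟩, rfl⟩
      · exact ⟨Sum.inr ⟨x, h₂ i trivial x hi⟩, rfl⟩
    choose d hd using hd
    refine ⟨d, fun a => (isIncOn_iff _ _).2 ?_, fun b => (isDecOn_iff _ _).2 ?_⟩
    · intro i hi j hj hij
      exact h₃ i trivial j trivial hij a (by rw [hd, hi]; rfl) (by rw [hd, hj]; rfl)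
    · intro i hi j hj hij
      exact h₄ i trivial j trivial hij b (by rw [hd, hi]; rfl) (by rw [hd, hj]; rfl)

/-- The permutation obtained from `π` by deleting the entry at index `x`. -/
def deleteEntry {n : ℕ} (π : Equiv.Perm (Fin (n + 1))) (x : Fin (n + 1)) : Equiv.Perm (Fin n) :=
  (finSuccAboveOrderIso x).toEquiv.trans
    ((π.subtypeEquiv (q := (· ≠ π x)) fun _ => π.injective.ne_iff.symm).trans
      (finSuccAboveOrderIso (π x)).symm.toEquiv)

theorem deleteEntry_lt_iff {n : ℕ} (π : Equiv.Perm (Fin (n + 1))) (x : Fin (n + 1))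
    (i j : Fin n) :
    deleteEntry π x i < deleteEntry π x j ↔ π (x.succAbove i) < π (x.succAbove j) :=
  (finSuccAboveOrderIso (π x)).symm.lt_iff_lt

theorem nonInv_iff_of_pattern {m n : ℕ} {τ : Equiv.Perm (Fin m)} {π : Equiv.Perm (Fin n)}
    {f : Fin m → Fin n} (hf : StrictMono f) (h : ∀ i j, τ i < τ j ↔ π (f i) < π (f j))
    (i j : Fin m) : NonInv τ i j ↔ NonInv π (f i) (f j) := by
  simp only [NonInv, h, hf.lt_iff_lt]

theorem aMinimal_T_iff {n : ℕ} (π : Equiv.Perm (Fin n)) (k : ℕ) :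
    AMinimal π (T k) ↔ RelMinimal (NonInv π) k := by
  constructor
  · rintro ⟨⟨-, hcrit⟩, hD⟩
    refine ⟨fun r s => ?_, fun x => ?_⟩
    · have hrs : (r, s) ∈ DSet π ↔ (r, s) ∈ T k := by rw [hD]
      rw [← coverable_iff_relCover, ← not_le]
      exact (not_iff_comm.1 hrs).symm
    · obtain _ | n := n
      · exact x.elim0
      obtain ⟨⟨r, s⟩, hrs, hc⟩ := hcrit n (deleteEntry π x)
        ⟨n.lt_succ_self, x.succAbove, x.strictMono_succAbove, deleteEntry_lt_iff π x⟩
      rw [coverable_iff_relCover] at hc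
      have hrs' : r + s ≤ k := hrs
      refine ⟨r, k - r, by omega, ?_⟩
      have himage := hc.image (v := NonInv π) x.succAbove x.strictMono_succAbove.injective
        (nonInv_iff_of_pattern x.strictMono_succAbove (deleteEntry_lt_iff π x))
      rw [Set.image_univ, Fin.range_succAbove] at himage
      exact himage.mono le_rfl (by omega)
  · rintro ⟨hiff, hcompl⟩
    refine ⟨⟨?_, ?_⟩, ?_⟩
    · rintro ⟨⟨r, s⟩, hrs, hc⟩
      exact ((hiff r s).1 ((coverable_iff_relCover π r s).1 hc)).not_ge hrs
    · rintro m τ ⟨hmn, f, hf, hτ⟩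
      have hsurj : ¬ Function.Surjective f := fun hs => by
        have := Fintype.card_le_of_surjective f hs
        simp only [Fintype.card_fin] at this
        omega
      obtain ⟨x, hx⟩ := not_forall.1 hsurj
      obtain ⟨r, s, hrs, hc⟩ := hcompl x
      refine ⟨(r, s), hrs.le, (coverable_iff_relCover τ r s).2 ?_⟩
      exact hc.comap f hf.injective (fun i _ hi => hx ⟨i, hi⟩) (nonInv_iff_of_pattern hf hτ)
    · ext ⟨r, s⟩
      change ¬ Coverable π r s ↔ r + s ≤ k
      rw [coverable_iff_relCover, hiff, not_lt]

theorem nonInv_directSum {n m : ℕ} (π : Equiv.Perm (Fin n)) (σ : Equiv.Perm (Fin m))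
    (i j : Fin n ⊕ Fin m) :
    NonInv (directSum π σ) (finSumFinEquiv i) (finSumFinEquiv j) ↔
      sumRel (NonInv π) (NonInv σ) True i j := by
  rcases i with i | i <;> rcases j with j | j <;>
    simp [NonInv, directSum, sumRel, Fin.lt_def, -Fin.val_fin_lt] <;> omega

theorem nonInv_skewSum {n m : ℕ} (π : Equiv.Perm (Fin n)) (σ : Equiv.Perm (Fin m))
    (i j : Fin n ⊕ Fin m) :
    NonInv (skewSum π σ) (finSumFinEquiv i) (finSumFinEquiv j) ↔
      sumRel (NonInv π) (NonInv σ) False i j := by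
  rcases i with i | i <;> rcases j with j | j <;>
    simp [NonInv, skewSum, sumRel, Fin.lt_def, -Fin.val_fin_lt] <;> omega

theorem RelMinimal.skewSum_directSum {a b c d k : ℕ} {π₁ : Equiv.Perm (Fin a)}
    {π₂ : Equiv.Perm (Fin b)} {π₃ : Equiv.Perm (Fin c)} {π₄ : Equiv.Perm (Fin d)}
    (h : RelMinimal (sumRel (sumRel (NonInv π₁) (NonInv π₂) True)
      (sumRel (NonInv π₃) (NonInv π₄) True) False) k) :
    RelMinimal (NonInv (skewSum (directSum π₁ π₂) (directSum π₃ π₄))) k := by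
  refine h.congr ((Equiv.sumCongr finSumFinEquiv finSumFinEquiv).trans finSumFinEquiv) ?_
  intro i j
  rw [Equiv.trans_apply, Equiv.trans_apply, nonInv_skewSum]
  rcases i with i | i <;> rcases j with j | j
  · exact nonInv_directSum π₁ π₂ i j
  · rfl
  · rfl
  · exact nonInv_directSum π₃ π₄ i j

/-- If `π` is `T(k)`-minimal and `σ` is `T(k+1)`-minimal, then
`(π ⊕ π) ⊖ (π ⊕ σ)` is `T(2k+2)`-minimal and `(π ⊕ σ) ⊖ (σ ⊕ σ)` is `T(2k+3)`-minimal. -/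
theorem Tminimal_doubling {n m : ℕ} (k : ℕ) (π : Equiv.Perm (Fin n)) (σ : Equiv.Perm (Fin m))
    (hπ : AMinimal π (T k)) (hσ : AMinimal σ (T (k + 1))) :
    AMinimal (skewSum (directSum π π) (directSum π σ)) (T (2 * k + 2)) ∧
    AMinimal (skewSum (directSum π σ) (directSum σ σ)) (T (2 * k + 3)) := by
  rw [aMinimal_T_iff] at hπ hσ
  simp only [aMinimal_T_iff]
  exact ⟨(hπ.doubling_even hσ).skewSum_directSum, (hπ.doubling_odd hσ).skewSum_directSum⟩
end

section
/- The permutation π₁₂ = 10 5 1 7 11 4 9 2 6 12 8 3 of length 12 is 3-critical: π₁₂ is not 3-coverable, but every proper pattern of π₁₂ is 3-coverable. Moreover, D(π₁₂) = T(3), i.e. π₁₂ is (r,s)-coverable for every (r,s) with r+s = 4. -/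
/-- The permutation `π₁₂ = 10 5 1 7 11 4 9 2 6 12 8 3` (0-indexed below). -/
def pi12 : Equiv.Perm (Fin 12) :=
  ⟨![9, 4, 0, 6, 10, 3, 8, 1, 5, 11, 7, 2],
   ![2, 7, 11, 5, 1, 8, 3, 10, 6, 0, 4, 9], by decide, by decide⟩

/-- The colouring `c` is valid on the indices satisfying `P`: classes labelled `inl` are increasing
and classes labelled `inr` are decreasing there. -/
def IsCoverOn {n r s : ℕ} (π : Equiv.Perm (Fin n)) (P : Fin n → Prop)
    (c : Fin n → Fin r ⊕ Fin s) : Prop :=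
  ∀ i, P i → ∀ j, P j → i < j → c i = c j →
    ((c i).isLeft → π i < π j) ∧ ((c i).isRight → π j < π i)

instance {n r s : ℕ} (π : Equiv.Perm (Fin n)) (P : Fin n → Prop) [DecidablePred P]
    (c : Fin n → Fin r ⊕ Fin s) : Decidable (IsCoverOn π P c) := by
  unfold IsCoverOn
  infer_instance

theorem IsCoverOn.coverable_of_pattern {m n r s : ℕ} {π : Equiv.Perm (Fin n)}
    {τ : Equiv.Perm (Fin m)} {P : Fin n → Prop} {c : Fin n → Fin r ⊕ Fin s}
    (hc : IsCoverOn π P c) {f : Fin m → Fin n} (hf : StrictMono f)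
    (hτ : ∀ i j, τ i < τ j ↔ π (f i) < π (f j)) (hP : ∀ i, P (f i)) :
    Coverable τ r s := by
  refine ⟨c ∘ f, fun a i hi j hj hij => ?_, fun b i hi j hj hij => ?_⟩ <;>
    simp only [Set.mem_ofPred_eq, Function.comp_apply] at hi hj
  · exact (hτ i j).2 ((hc _ (hP i) _ (hP j) (hf hij) (hi.trans hj.symm)).1 (by simp [hi]))
  · exact (hτ j i).2 ((hc _ (hP i) _ (hP j) (hf hij) (hi.trans hj.symm)).2 (by simp [hi]))

theorem IsCoverOn.coverable {n r s : ℕ} {π : Equiv.Perm (Fin n)} {c : Fin n → Fin r ⊕ Fin s}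
    (hc : IsCoverOn π (fun _ => True) c) : Coverable π r s :=
  hc.coverable_of_pattern strictMono_id (fun _ _ => Iff.rfl) (fun _ => trivial)

theorem Coverable.mono {n r s r' s' : ℕ} {π : Equiv.Perm (Fin n)} (h : Coverable π r s)
    (hr : r ≤ r') (hs : s ≤ s') : Coverable π r' s' := by
  obtain ⟨c, hinc, hdec⟩ := h
  refine ⟨fun i => Sum.map (Fin.castLE hr) (Fin.castLE hs) (c i),
    fun a i hi j hj hij => ?_, fun b i hi j hj hij => ?_⟩ <;>
    rcases hx : c i with x | x <;> rcases hy : c j with y | y <;>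
    simp only [Set.mem_ofPred_eq, hx, hy, Sum.map_inl, Sum.map_inr, Sum.inl.injEq, Sum.inr.injEq,
      reduceCtorEq] at hi hj <;>
    obtain rfl := Fin.castLE_injective _ (hi.trans hj.symm)
  · exact hinc _ i hx j hy hij
  · exact hdec _ i hx j hy hij

/-- Whether the entries of `π` at the indices in `l` can be appended one by one to `r` increasing
sequences and `s` decreasing sequences, where the next entry of the `a`-th increasing sequence must
be at least `lo a` and the next entry of the `b`-th decreasing sequence must be less than `hi b`. -/
def CanExtend {n r s : ℕ} (π : Equiv.Perm (Fin n)) :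
    List (Fin n) → (Fin r → ℕ) → (Fin s → ℕ) → Prop
  | [], _, _ => True
  | i :: l, lo, hi =>
    (∃ a, lo a ≤ π i ∧ CanExtend π l (Function.update lo a (π i + 1)) hi) ∨
      ∃ b, π i < hi b ∧ CanExtend π l lo (Function.update hi b (π i))

instance CanExtend.decidable {n r s : ℕ} (π : Equiv.Perm (Fin n)) :
    ∀ (l : List (Fin n)) (lo : Fin r → ℕ) (hi : Fin s → ℕ), Decidable (CanExtend π l lo hi)
  | [], _, _ => isTrue trivial
  | i :: l, lo, hi =>
    have := CanExtend.decidable (r := r) (s := s) π l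
    inferInstanceAs (Decidable
      ((∃ a, lo a ≤ π i ∧ CanExtend π l (Function.update lo a (π i + 1)) hi) ∨
        ∃ b, π i < hi b ∧ CanExtend π l lo (Function.update hi b (π i))))

theorem canExtend_of_cover {n r s : ℕ} {π : Equiv.Perm (Fin n)} {c : Fin n → Fin r ⊕ Fin s}
    (hinc : ∀ a : Fin r, IsIncOn π {i | c i = Sum.inl a})
    (hdec : ∀ b : Fin s, IsDecOn π {i | c i = Sum.inr b}) :
    ∀ (l : List (Fin n)) (lo : Fin r → ℕ) (hi : Fin s → ℕ), l.Pairwise (· < ·) →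
      (∀ a, ∀ i ∈ l, c i = Sum.inl a → lo a ≤ π i) →
      (∀ b, ∀ i ∈ l, c i = Sum.inr b → π i < hi b) → CanExtend π l lo hi
  | [], _, _, _, _, _ => trivial
  | i :: l, lo, hi, hl, hlo, hhi => by
    rw [List.pairwise_cons] at hl
    rcases hci : c i with a | b
    · refine Or.inl ⟨a, hlo a i List.mem_cons_self hci,
        canExtend_of_cover hinc hdec l _ _ hl.2 (fun a' j hj hcj => ?_)
          fun b j hj => hhi b j (List.mem_cons_of_mem i hj)⟩
      rcases eq_or_ne a' a with rfl | ha
      · simpa [Nat.succ_le_iff] using hinc a' i hci j hcj (hl.1 j hj)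
      · simpa [ha] using hlo a' j (List.mem_cons_of_mem i hj) hcj
    · refine Or.inr ⟨b, hhi b i List.mem_cons_self hci,
        canExtend_of_cover hinc hdec l _ _ hl.2
          (fun a j hj => hlo a j (List.mem_cons_of_mem i hj)) fun b' j hj hcj => ?_⟩
      rcases eq_or_ne b' b with rfl | hb
      · simpa using hdec b' i hci j hcj (hl.1 j hj)
      · simpa [hb] using hhi b' j (List.mem_cons_of_mem i hj) hcj

theorem Coverable.canExtend {n r s : ℕ} {π : Equiv.Perm (Fin n)} (h : Coverable π r s) :
    CanExtend π (List.finRange n) (fun _ : Fin r => 0) (fun _ : Fin s => n) := by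
  obtain ⟨c, hinc, hdec⟩ := h
  exact canExtend_of_cover hinc hdec _ _ _ (List.pairwise_lt_finRange n)
    (fun _ _ _ _ => Nat.zero_le _) fun _ i _ _ => (π i).isLt

theorem not_kCoverable_pi12 : ¬ KCoverable pi12 3 := by
  rintro ⟨r, s, hrs, h⟩
  replace h := h.canExtend
  obtain ⟨rfl, rfl⟩ | ⟨rfl, rfl⟩ | ⟨rfl, rfl⟩ | ⟨rfl, rfl⟩ :
      r = 0 ∧ s = 3 ∨ r = 1 ∧ s = 2 ∨ r = 2 ∧ s = 1 ∨ r = 3 ∧ s = 0 := by omega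
  all_goals
    revert h
    decide +kernel

theorem coverable_pi12 {r s : ℕ} (h : r + s = 4) : Coverable pi12 r s := by
  obtain ⟨rfl, rfl⟩ | ⟨rfl, rfl⟩ | ⟨rfl, rfl⟩ | ⟨rfl, rfl⟩ | ⟨rfl, rfl⟩ :
      r = 0 ∧ s = 4 ∨ r = 1 ∧ s = 3 ∨ r = 2 ∧ s = 2 ∨ r = 3 ∧ s = 1 ∨ r = 4 ∧ s = 0 := by omega
  · exact IsCoverOn.coverable (c := ![.inr 0, .inr 0, .inr 0, .inr 1, .inr 2, .inr 1,
      .inr 2, .inr 1, .inr 2, .inr 3, .inr 3, .inr 2]) (by decide +kernel)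
  · exact IsCoverOn.coverable (c := ![.inr 0, .inl 0, .inr 0, .inr 1, .inr 2, .inr 1,
      .inr 2, .inr 1, .inl 0, .inl 0, .inr 2, .inr 2]) (by decide +kernel)
  · exact IsCoverOn.coverable (c := ![.inl 0, .inr 0, .inl 1, .inl 1, .inl 0, .inr 0,
      .inr 1, .inr 0, .inr 1, .inl 0, .inl 1, .inr 1]) (by decide +kernel)
  · exact IsCoverOn.coverable (c := ![.inl 0, .inl 1, .inl 2, .inl 1, .inl 0, .inr 0,
      .inl 1, .inl 2, .inl 2, .inl 0, .inl 2, .inr 0]) (by decide +kernel)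
  · exact IsCoverOn.coverable (c := ![.inl 0, .inl 1, .inl 2, .inl 1, .inl 0, .inl 2,
      .inl 1, .inl 3, .inl 2, .inl 0, .inl 2, .inl 3]) (by decide +kernel)

theorem exists_isCoverOn_pi12_compl (k : Fin 12) :
    ∃ r s, r + s = 3 ∧ ∃ c : Fin 12 → Fin r ⊕ Fin s, IsCoverOn pi12 (· ≠ k) c := by
  fin_cases k
  · exact ⟨2, 1, rfl, ![.inl 0, .inl 0, .inl 1, .inl 0, .inr 0, .inr 0,
      .inl 0, .inl 1, .inl 1, .inl 0, .inl 1, .inr 0], by decide +kernel⟩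
  · exact ⟨1, 2, rfl, ![.inr 0, .inl 0, .inl 0, .inr 0, .inr 1, .inl 0,
      .inr 1, .inr 0, .inl 0, .inl 0, .inr 1, .inr 1], by decide +kernel⟩
  · exact ⟨1, 2, rfl, ![.inr 0, .inl 0, .inl 0, .inr 0, .inr 1, .inr 0,
      .inr 1, .inr 0, .inl 0, .inl 0, .inr 1, .inr 1], by decide +kernel⟩
  · exact ⟨1, 2, rfl, ![.inr 0, .inr 0, .inl 0, .inl 0, .inr 1, .inl 0,
      .inr 1, .inr 0, .inl 0, .inl 0, .inr 1, .inr 1], by decide +kernel⟩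
  · exact ⟨2, 1, rfl, ![.inr 0, .inl 0, .inl 1, .inl 0, .inl 0, .inr 0,
      .inl 0, .inl 1, .inl 1, .inl 0, .inl 1, .inr 0], by decide +kernel⟩
  · exact ⟨2, 1, rfl, ![.inr 0, .inl 0, .inl 1, .inl 0, .inl 0, .inl 0,
      .inr 0, .inl 1, .inl 1, .inl 0, .inl 1, .inr 0], by decide +kernel⟩
  · exact ⟨2, 1, rfl, ![.inr 0, .inl 0, .inl 1, .inl 0, .inl 0, .inr 0,
      .inl 0, .inl 1, .inl 1, .inl 0, .inl 1, .inr 0], by decide +kernel⟩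
  · exact ⟨2, 1, rfl, ![.inr 0, .inl 0, .inl 1, .inl 0, .inl 0, .inl 1,
      .inr 0, .inl 0, .inl 1, .inl 0, .inl 1, .inr 0], by decide +kernel⟩
  · exact ⟨1, 2, rfl, ![.inr 0, .inr 0, .inl 0, .inl 0, .inl 0, .inr 0,
      .inr 1, .inr 0, .inl 0, .inl 0, .inr 1, .inr 1], by decide +kernel⟩
  · exact ⟨1, 2, rfl, ![.inr 0, .inr 0, .inl 0, .inl 0, .inr 1, .inr 0,
      .inr 1, .inr 0, .inr 1, .inl 0, .inl 0, .inr 1], by decide +kernel⟩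
  · exact ⟨1, 2, rfl, ![.inr 0, .inr 0, .inl 0, .inl 0, .inl 0, .inr 0,
      .inr 1, .inr 0, .inr 1, .inl 0, .inl 0, .inr 1], by decide +kernel⟩
  · exact ⟨2, 1, rfl, ![.inr 0, .inl 0, .inl 1, .inl 0, .inl 0, .inl 1,
      .inr 0, .inr 0, .inl 1, .inl 0, .inl 1, .inl 0], by decide +kernel⟩

/-- `π₁₂` is 3-critical, and moreover `D(π₁₂) = T(3)` (i.e. it is `T(3)`-minimal). -/
theorem pi12_critical : KCritical pi12 3 ∧ DSet pi12 = T 3 := by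
  refine ⟨⟨not_kCoverable_pi12, ?_⟩, ?_⟩
  · rintro m τ ⟨hm, f, hf, hτ⟩
    obtain ⟨k, hk⟩ : ∃ k, ∀ i, f i ≠ k := by
      by_contra! hsurj
      have := Fintype.card_le_of_surjective f hsurj
      simp only [Fintype.card_fin] at this
      omega
    obtain ⟨r, s, hrs, c, hc⟩ := exists_isCoverOn_pi12_compl k
    exact ⟨r, s, hrs, hc.coverable_of_pattern hf hτ hk⟩
  · ext ⟨r, s⟩
    simp only [DSet, T, Set.mem_ofPred_eq]
    constructor
    · intro h
      by_contra! hrs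
      exact h ((coverable_pi12 (r := min r 4) (s := 4 - min r 4) (by omega)).mono
        (by omega) (by omega))
    · intro hrs h
      exact not_kCoverable_pi12 ⟨r, 3 - r, by omega, h.mono le_rfl (by omega)⟩
end

section
/- The permutation π₉ = 5 2 7 1 6 3 9 8 4 of length 9 is (2,1)-critical: π₉ is not (2,1)-coverable, but every proper pattern of π₉ is (2,1)-coverable. -/
/-- The permutation `π₉ = 5 2 7 1 6 3 9 8 4` (0-indexed below). -/
def pi9 : Equiv.Perm (Fin 9) :=
  ⟨![4, 1, 6, 0, 5, 2, 8, 7, 3],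
   ![3, 1, 5, 8, 0, 4, 2, 7, 6], by decide, by decide⟩

/-- If all indices of `π` other than `p` can be covered, then so can every pattern of `π`
whose embedding misses `p`. -/
lemma Coverable.of_pattern_avoiding {m n r s : ℕ} {τ : Equiv.Perm (Fin m)}
    {π : Equiv.Perm (Fin n)} {f : Fin m → Fin n} (hf : StrictMono f)
    (hτ : ∀ i j, τ i < τ j ↔ π (f i) < π (f j)) {p : Fin n} (hp : ∀ i, f i ≠ p)
    (c : Fin n → Fin r ⊕ Fin s)
    (hinc : ∀ a, IsIncOn π {i | i ≠ p ∧ c i = Sum.inl a})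
    (hdec : ∀ b, IsDecOn π {i | i ≠ p ∧ c i = Sum.inr b}) : Coverable τ r s :=
  ⟨c ∘ f,
    fun a i hi j hj hij => (hτ i j).2 (hinc a _ ⟨hp i, hi⟩ _ ⟨hp j, hj⟩ (hf hij)),
    fun b i hi j hj hij => (hτ j i).2 (hdec b _ ⟨hp i, hi⟩ _ ⟨hp j, hj⟩ (hf hij))⟩

/-- Two increasing subsequences cannot cover a decreasing triple. -/
lemma exists_inr_of_decreasing_triple {n s : ℕ} {π : Equiv.Perm (Fin n)}
    {c : Fin n → Fin 2 ⊕ Fin s} (hinc : ∀ a, IsIncOn π {i | c i = Sum.inl a})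
    {i j k : Fin n} (hij : i < j) (hjk : j < k) (hji : π j < π i) (hkj : π k < π j) :
    (∃ b, c i = Sum.inr b) ∨ (∃ b, c j = Sum.inr b) ∨ ∃ b, c k = Sum.inr b := by
  have separated : ∀ {x y : Fin n} {a b : Fin 2}, x < y → π y < π x →
      c x = Sum.inl a → c y = Sum.inl b → a ≠ b := by
    rintro x y a _ hxy hyx hx hy rfl
    exact lt_asymm hyx (hinc a x hx y hy hxy)
  rcases hi : c i with a | b
  · rcases hj : c j with a' | b
    · rcases hk : c k with a'' | b
      · have h₁ := separated hij hji hi hj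
        have h₂ := separated hjk hkj hj hk
        have h₃ := separated (hij.trans hjk) (hkj.trans hji) hi hk
        omega
      · exact Or.inr (Or.inr ⟨b, rfl⟩)
    · exact Or.inr (Or.inl ⟨b, rfl⟩)
  · exact Or.inl ⟨b, rfl⟩

lemma pi9_not_coverable : ¬ Coverable pi9 2 1 := by
  rintro ⟨c, hinc, hdec⟩
  have hits : ∀ {i j k : Fin 9}, i < j → j < k → pi9 j < pi9 i → pi9 k < pi9 j →
      c i = Sum.inr 0 ∨ c j = Sum.inr 0 ∨ c k = Sum.inr 0 := fun h₁ h₂ h₃ h₄ => by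
    simpa [Fin.exists_fin_one] using exists_inr_of_decreasing_triple hinc h₁ h₂ h₃ h₄
  have no_ascent : ∀ {i j : Fin 9}, i < j → pi9 i < pi9 j →
      c i = Sum.inr 0 → c j = Sum.inr 0 → False := fun hij h hi hj =>
    lt_asymm h (hdec 0 _ hi _ hj hij)
  have first := hits (i := 0) (j := 1) (k := 3) (by decide) (by decide) (by decide) (by decide)
  have middle := hits (i := 2) (j := 4) (k := 5) (by decide) (by decide) (by decide) (by decide)
  have last := hits (i := 6) (j := 7) (k := 8) (by decide) (by decide) (by decide) (by decide)
  rcases first with h | h | h <;> rcases last with h' | h' | h' <;>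
    first
    | exact no_ascent (by decide) (by decide) h h'
    | rcases middle with h'' | h'' | h'' <;>
        first
        | exact no_ascent (by decide) (by decide) h h''
        | exact no_ascent (by decide) (by decide) h'' h'

/-- A colouring of `π₉` that is a `(2,1)`-cover away from the index `p`. -/
def pi9Cover : Fin 9 → Fin 9 → Fin 2 ⊕ Fin 1 :=
  let x : Fin 2 ⊕ Fin 1 := Sum.inl 0
  let y : Fin 2 ⊕ Fin 1 := Sum.inl 1
  let d : Fin 2 ⊕ Fin 1 := Sum.inr 0
  ![![x, x, x, y, d, y, x, y, d],
    ![x, x, x, y, d, y, x, y, d],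
    ![d, x, x, y, x, y, x, y, d],
    ![x, y, x, x, d, y, x, y, d],
    ![d, x, x, y, x, y, x, y, d],
    ![d, x, x, y, y, x, x, y, d],
    ![x, y, d, d, x, y, x, x, y],
    ![x, y, d, d, x, y, x, x, y],
    ![x, y, d, d, x, y, x, y, x]]

lemma pi9Cover_isIncOn (p : Fin 9) (a : Fin 2) :
    IsIncOn pi9 {i | i ≠ p ∧ pi9Cover p i = Sum.inl a} := by
  simp only [IsIncOn, Set.mem_ofPred_eq]
  revert p a
  decide

lemma pi9Cover_isDecOn (p : Fin 9) (b : Fin 1) :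
    IsDecOn pi9 {i | i ≠ p ∧ pi9Cover p i = Sum.inr b} := by
  simp only [IsDecOn, Set.mem_ofPred_eq]
  revert p b
  decide

/-- `π₉` is `(2,1)`-critical. -/
theorem pi9_critical : RSCritical pi9 2 1 := by
  refine ⟨pi9_not_coverable, ?_⟩
  rintro m τ ⟨hm, f, hf, hτ⟩
  have hsurj : ¬ Function.Surjective f := fun h => by
    have := Fintype.card_le_of_surjective f h
    simp only [Fintype.card_fin] at this
    omega
  obtain ⟨p, hp⟩ := not_forall.1 hsurj
  exact Coverable.of_pattern_avoiding hf hτ (fun i h => hp ⟨i, h⟩) (pi9Cover p)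
    (pi9Cover_isIncOn p) (pi9Cover_isDecOn p)
end

section
/- The permutation π₁₅ = 12 14 5 10 3 9 1 7 15 13 11 4 2 8 6 of length 15 is (2,2)-sharp: π₁₅ is not (2,2)-coverable, every proper pattern of π₁₅ is (2,2)-coverable, and π₁₅ is (0,3)-coverable. -/
/-- The permutation `π₁₅ = 12 14 5 10 3 9 1 7 15 13 11 4 2 8 6` (0-indexed below). -/
def pi15 : Equiv.Perm (Fin 15) :=
  ⟨![11, 13, 4, 9, 2, 8, 0, 6, 14, 12, 10, 3, 1, 7, 5],
   ![6, 12, 4, 11, 2, 14, 7, 13, 5, 3, 10, 0, 9, 1, 8], by decide, by decide⟩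

/-- Backtracking search deciding whether the list of values can be split into two increasing
sequences with all entries at least `a`, `b` respectively and two decreasing sequences with all
entries below `c`, `d` respectively. -/
def searchTwoTwo : List ℕ → ℕ → ℕ → ℕ → ℕ → Bool
  | [], _, _, _, _ => true
  | v :: l, a, b, c, d =>
    (Nat.ble a v && searchTwoTwo l (v + 1) b c d) ||
    (Nat.ble b v && searchTwoTwo l a (v + 1) c d) ||
    (Nat.blt v c && searchTwoTwo l a b v d) ||
    (Nat.blt v d && searchTwoTwo l a b c v)

/-- Two coloured values, in this order, may occur in the same cover: if they share a colour, they
are increasing or decreasing as that colour demands. -/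
def ColorCompatible (x y : ℕ × (Fin 2 ⊕ Fin 2)) : Prop :=
  x.2 = y.2 → (x.2.isLeft → x.1 < y.1) ∧ (x.2.isRight → y.1 < x.1)

/-- A coloured value respects the bounds attached to the four colours. -/
def RespectsBounds (a b c d : ℕ) (x : ℕ × (Fin 2 ⊕ Fin 2)) : Prop :=
  (x.2 = Sum.inl 0 → a ≤ x.1) ∧ (x.2 = Sum.inl 1 → b ≤ x.1) ∧
  (x.2 = Sum.inr 0 → x.1 < c) ∧ (x.2 = Sum.inr 1 → x.1 < d)

theorem searchTwoTwo_eq_true (l : List (ℕ × (Fin 2 ⊕ Fin 2))) (a b c d : ℕ)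
    (hl : l.Pairwise ColorCompatible) (hb : ∀ x ∈ l, RespectsBounds a b c d x) :
    searchTwoTwo (l.map Prod.fst) a b c d = true := by
  induction l generalizing a b c d with
  | nil => rfl
  | cons x l ih =>
    obtain ⟨v, k⟩ := x
    obtain ⟨hv, hl'⟩ := List.pairwise_cons.1 hl
    obtain ⟨hx, hb'⟩ := List.forall_mem_cons.1 hb
    simp only [List.map_cons, searchTwoTwo, Bool.or_eq_true, Bool.and_eq_true, Nat.ble_eq,
      Nat.blt_eq]
    obtain ⟨h₁, h₂, h₃, h₄⟩ := hx
    rcases k with k | k <;> fin_cases k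
    · refine .inl <| .inl <| .inl ⟨h₁ rfl, ih _ _ _ _ hl' fun y hy => ?_⟩
      exact ⟨fun h => ((hv y hy) h.symm).1 rfl, (hb' y hy).2⟩
    · refine .inl <| .inl <| .inr ⟨h₂ rfl, ih _ _ _ _ hl' fun y hy => ?_⟩
      exact ⟨(hb' y hy).1, fun h => ((hv y hy) h.symm).1 rfl, (hb' y hy).2.2⟩
    · refine .inl <| .inr ⟨h₃ rfl, ih _ _ _ _ hl' fun y hy => ?_⟩
      exact ⟨(hb' y hy).1, (hb' y hy).2.1, fun h => ((hv y hy) h.symm).2 rfl, (hb' y hy).2.2.2⟩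
    · refine .inr ⟨h₄ rfl, ih _ _ _ _ hl' fun y hy => ?_⟩
      exact ⟨(hb' y hy).1, (hb' y hy).2.1, (hb' y hy).2.2.1, fun h => ((hv y hy) h.symm).2 rfl⟩

theorem Coverable.searchTwoTwo_eq_true {n : ℕ} {π : Equiv.Perm (Fin n)} (h : Coverable π 2 2) :
    searchTwoTwo (List.ofFn fun i => (π i : ℕ)) 0 0 n n = true := by
  obtain ⟨c, hinc, hdec⟩ := h
  have key := _root_.searchTwoTwo_eq_true (List.ofFn fun i => ((π i : ℕ), c i)) 0 0 n n ?_ ?_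
  · simpa [List.map_ofFn, Function.comp_def] using key
  · refine List.pairwise_ofFn.2 fun i j hij hc => ⟨fun hi => ?_, fun hi => ?_⟩
    · obtain ⟨k, hk⟩ := Sum.isLeft_iff.1 hi
      exact hinc k i hk j (hc.symm.trans hk) hij
    · obtain ⟨k, hk⟩ := Sum.isRight_iff.1 hi
      exact hdec k i hk j (hc.symm.trans hk) hij
  · simp [List.mem_ofFn, RespectsBounds]

theorem pi15_not_coverable : ¬ Coverable pi15 2 2 := by
  intro h
  have hs : searchTwoTwo [11, 13, 4, 9, 2, 8, 0, 6, 14, 12, 10, 3, 1, 7, 5] 0 0 15 15 = true :=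
    h.searchTwoTwo_eq_true
  have hf : searchTwoTwo [11, 13, 4, 9, 2, 8, 0, 6, 14, 12, 10, 3, 1, 7, 5] 0 0 15 15 = false := by
    decide +kernel
  exact Bool.false_ne_true (hf.symm.trans hs)

/-- A pattern whose occurrence avoids the index `k` is coverable as soon as the indices other than
`k` are. -/
theorem coverable_of_avoiding {m n r s : ℕ} {τ : Equiv.Perm (Fin m)} {π : Equiv.Perm (Fin n)}
    {f : Fin m → Fin n} (hf : StrictMono f) (hτ : ∀ i j, τ i < τ j ↔ π (f i) < π (f j))
    {k : Fin n} (hk : ∀ i, f i ≠ k) (c : Fin n → Fin r ⊕ Fin s)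
    (hc : ∀ i j, i ≠ k → j ≠ k → i < j → c i = c j →
      ((c i).isLeft → π i < π j) ∧ ((c i).isRight → π j < π i)) : Coverable τ r s := by
  refine ⟨c ∘ f, fun a i hi j hj hij => ?_, fun b i hi j hj hij => ?_⟩ <;>
    simp only [Set.mem_ofPred_eq, Function.comp_apply] at hi hj
  · exact (hτ _ _).2 ((hc _ _ (hk i) (hk j) (hf hij) (hi.trans hj.symm)).1 (by simp [hi]))
  · exact (hτ _ _).2 ((hc _ _ (hk i) (hk j) (hf hij) (hi.trans hj.symm)).2 (by simp [hi]))

/-- Row `k` describes a cover of `pi15` with the index `k` removed; the colours `0`, `1` are the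
increasing ones and `2`, `3` the decreasing ones, and the entry at `k` itself is irrelevant. -/
def pi15DeletionColor : Fin 15 → Fin 15 → Fin 4 :=
  ![![0, 2, 0, 2, 1, 2, 2, 0, 3, 3, 3, 1, 3, 0, 1],
    ![2, 0, 0, 2, 1, 2, 2, 0, 3, 3, 3, 1, 3, 0, 1],
    ![2, 3, 0, 2, 0, 0, 1, 1, 0, 1, 3, 2, 2, 3, 3],
    ![2, 3, 2, 0, 0, 0, 1, 1, 0, 1, 3, 2, 2, 3, 3],
    ![2, 3, 0, 0, 0, 2, 1, 1, 0, 1, 3, 2, 2, 3, 3],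
    ![2, 3, 0, 2, 2, 0, 1, 0, 0, 3, 3, 1, 2, 1, 3],
    ![2, 3, 0, 0, 1, 1, 0, 2, 0, 1, 3, 2, 2, 3, 3],
    ![2, 3, 0, 2, 2, 0, 1, 0, 0, 3, 3, 1, 2, 1, 3],
    ![2, 3, 0, 2, 1, 2, 2, 0, 0, 3, 3, 1, 3, 0, 1],
    ![2, 3, 2, 3, 0, 0, 1, 1, 0, 0, 1, 2, 2, 3, 3],
    ![2, 3, 2, 3, 0, 0, 1, 1, 0, 1, 0, 2, 2, 3, 3],
    ![2, 3, 0, 2, 2, 0, 1, 1, 0, 1, 3, 0, 2, 3, 3],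
    ![2, 3, 0, 2, 1, 2, 2, 0, 0, 3, 3, 1, 0, 1, 3],
    ![2, 3, 0, 2, 1, 2, 2, 0, 0, 3, 3, 1, 3, 0, 1],
    ![2, 3, 0, 0, 1, 2, 2, 1, 0, 3, 3, 3, 3, 1, 0]]

theorem pi15_deletion_cover (k i j : Fin 15) (hi : i ≠ k) (hj : j ≠ k) (hij : i < j)
    (h : finSumFinEquiv.symm (pi15DeletionColor k i) =
      (finSumFinEquiv.symm (pi15DeletionColor k j) : Fin 2 ⊕ Fin 2)) :
    ((finSumFinEquiv.symm (pi15DeletionColor k i) : Fin 2 ⊕ Fin 2).isLeft →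
      pi15 i < pi15 j) ∧
    ((finSumFinEquiv.symm (pi15DeletionColor k i) : Fin 2 ⊕ Fin 2).isRight →
      pi15 j < pi15 i) := by
  revert k i j
  decide +kernel

theorem pi15_coverable_zero_three : Coverable pi15 0 3 := by
  refine ⟨fun i => Sum.inr (![0, 1, 0, 1, 0, 1, 0, 1, 2, 2, 2, 1, 1, 2, 2] i),
    fun a => a.elim0, ?_⟩
  simp only [IsDecOn, Set.mem_ofPred_eq]
  decide +kernel

/-- `π₁₅` is `(2,2)`-sharp: `(2,2)`-critical and `(0,3)`-coverable. -/
theorem pi15_sharp : RSSharp pi15 2 2 := by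
  refine ⟨⟨pi15_not_coverable, ?_⟩, pi15_coverable_zero_three⟩
  rintro m τ ⟨hm, f, hf, hτ⟩
  have hns : ¬ Function.Surjective f := by
    intro hs
    have := Fintype.card_le_of_surjective f hs
    simp only [Fintype.card_fin] at this
    omega
  simp only [Function.Surjective, not_forall, not_exists] at hns
  obtain ⟨k, hk⟩ := hns
  exact coverable_of_avoiding hf hτ hk _ (pi15_deletion_cover k)
end
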